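/- arXiv:1403.5962 — 2 statements merged into one kernel-verified Lean document; each statement's English description precedes it below -/
import Mathlib

section
/- The number of metasylvester classes of packed words of length n is (n+1)!/2 for n ≥ 1. -/
/-- One elementary metasylvester rewriting. -/
def MetaStep {α : Type*} [LinearOrder α] (w w' : List α) : Prop :=
  (∃ (u v x : List α) (a b : α), a < b ∧
      w = u ++ [a, b] ++ v ++ [a] ++ x ∧ w' = u ++ [b, a] ++ v ++ [a] ++ x) ∨
  (∃ (u v y x : List α) (a b c : α), a < b ∧ b < c ∧
      w = u ++ [b] ++ v ++ [a, c] ++ y ++ [b] ++ x ∧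
      w' = u ++ [b] ++ v ++ [c, a] ++ y ++ [b] ++ x)

/-- A word over `ℕ` is packed if its set of letters is an initial segment `{0,…,k-1}`. -/
def IsPacked (w : List ℕ) : Prop := ∀ k : ℕ, k + 1 ∈ w → k ∈ w

open List in
/-- A word avoids the pattern `a b a` with `a < b`. -/
def MAv (w : List ℕ) : Prop := ∀ a b, a < b → ¬ [a, b, a] <+ w

/-- At least `k` letters `c` occur before the last `a`. -/
def MQ (w : List ℕ) (a c k : ℕ) : Prop := ∃ u v, w = u ++ v ∧ a ∈ v ∧ k ≤ u.count c

def MR (w : List ℕ) (a b : ℕ) : Prop := a < b ∧ MQ w a b 1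

def MP (w : List ℕ) (a c k : ℕ) : Prop :=
  ∃ b, Relation.ReflTransGen (MR w) a b ∧ b < c ∧ MQ w b c k

theorem mq_swap1 (s t : List ℕ) (p q x z k : ℕ) (hpq : p < q) (hxz : x < z)
    (h : MQ (s ++ p :: q :: t) x z k) : MQ (s ++ q :: p :: t) x z k := by
  obtain ⟨u, v, h, hx, hk⟩ := h
  rcases List.append_eq_append_iff.1 h with ⟨a, rfl, h2⟩ | ⟨a, rfl, rfl⟩
  · match a, h2 with
    | [], h2 =>
      simp at h2
      subst h2
      exact ⟨s, q :: p :: t, rfl, by simp at hx ⊢; tauto, by simpa using hk⟩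
    | [y], h2 =>
      simp at h2
      obtain ⟨rfl, rfl⟩ := h2
      by_cases hz : z = p
      · subst hz
        refine ⟨s ++ [q, z], t, by simp, ?_, ?_⟩
        · simp at hx
          rcases hx with hx | hx
          · omega
          · exact hx
        · simp [List.count_cons] at hk ⊢; omega
      · refine ⟨s, q :: p :: t, rfl, by simp at hx ⊢; tauto, ?_⟩
        have : ¬ p = z := fun h => hz h.symm
        simpa [List.count_cons, this] using hk
    | y :: y' :: a, h2 =>
      simp at h2
      obtain ⟨rfl, rfl, rfl⟩ := h2
      refine ⟨s ++ q :: p :: a, v, by simp, hx, ?_⟩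
      simp [List.count_cons] at hk ⊢; omega
  · refine ⟨u, a ++ q :: p :: t, by simp, by simp at hx ⊢; tauto, hk⟩

theorem mq_swap2 (s t : List ℕ) (p q x z k : ℕ) (hpq : p < q) (hxz : x < z)
    (h : MQ (s ++ q :: p :: t) x z k) : MQ (s ++ p :: q :: t) x z k ∨
      (x = p ∧ z = q ∧ k ≤ s.count q + 1) := by
  obtain ⟨u, v, h, hx, hk⟩ := h
  rcases List.append_eq_append_iff.1 h with ⟨a, rfl, h2⟩ | ⟨a, rfl, rfl⟩
  · match a, h2 with
    | [], h2 =>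
      simp at h2
      subst h2
      exact Or.inl ⟨s, p :: q :: t, rfl, by simp at hx ⊢; tauto, by simpa using hk⟩
    | [y], h2 =>
      simp at h2
      obtain ⟨rfl, rfl⟩ := h2
      by_cases hz : z = q
      · subst hz
        simp at hx
        rcases hx with hx | hx
        · right
          refine ⟨hx, rfl, ?_⟩
          simpa using hk
        · left
          refine ⟨s ++ [p, z], t, by simp, hx, ?_⟩
          simp [List.count_cons] at hk ⊢; omega
      · left
        refine ⟨s, p :: q :: t, rfl, by simp at hx ⊢; tauto, ?_⟩
        have : ¬ q = z := fun h => hz h.symm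
        simpa [List.count_cons, this] using hk
    | y :: y' :: a, h2 =>
      simp at h2
      obtain ⟨rfl, rfl, rfl⟩ := h2
      left
      refine ⟨s ++ p :: q :: a, v, by simp, hx, ?_⟩
      simp [List.count_cons] at hk ⊢; omega
  · left
    refine ⟨u, a ++ p :: q :: t, by simp, by simp at hx ⊢; tauto, hk⟩

theorem step_form {w w' : List ℕ} (h : MetaStep w w') : ∃ s t p q, p < q ∧
    w = s ++ p :: q :: t ∧ w' = s ++ q :: p :: t ∧
    (p ∈ t ∨ ∃ b, p < b ∧ b < q ∧ b ∈ s ∧ b ∈ t) := by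
  rcases h with ⟨u, v, x, a, b, hab, rfl, rfl⟩ | ⟨u, v, y, x, a, b, c, hab, hbc, rfl, rfl⟩
  · exact ⟨u, v ++ a :: x, a, b, hab, by simp, by simp, by simp⟩
  · exact ⟨u ++ b :: v, y ++ b :: x, a, c, hab.trans hbc, by simp, by simp,
      Or.inr ⟨b, hab, hbc, by simp, by simp⟩⟩

theorem mq_step1 {w w' : List ℕ} (h : MetaStep w w') {x z k : ℕ} (hxz : x < z)
    (hq : MQ w x z k) : MQ w' x z k := by
  obtain ⟨s, t, p, q, hpq, rfl, rfl, -⟩ := step_form h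
  exact mq_swap1 s t p q x z k hpq hxz hq

theorem mq_step2 {w w' : List ℕ} (h : MetaStep w w') {x z k : ℕ} (hxz : x < z)
    (hq : MQ w' x z k) : MP w x z k := by
  obtain ⟨s, t, p, q, hpq, rfl, rfl, hh⟩ := step_form h
  rcases mq_swap2 s t p q x z k hpq hxz hq with h1 | ⟨rfl, rfl, hk⟩
  · exact ⟨x, .refl, hxz, h1⟩
  · rcases hh with h | ⟨b, h1, h2, h3, h4⟩
    · exact ⟨x, .refl, hxz, s ++ [x, z], t, by simp, h, by simp [List.count_cons]; omega⟩
    · refine ⟨b, .single ⟨h1, s, x :: z :: t, rfl, by simp, List.count_pos_iff.2 h3⟩, h2,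
        s ++ [x, z], t, by simp, h4, by simp [List.count_cons]; omega⟩

theorem mp_step {w w' : List ℕ} (h : MetaStep w w') (x z k : ℕ) : MP w x z k ↔ MP w' x z k := by
  constructor
  · rintro ⟨b, h1, h2, h3⟩
    refine ⟨b, Relation.ReflTransGen.mono (fun a b hab => ⟨hab.1, mq_step1 h hab.1 hab.2⟩) _ _ h1,
      h2, mq_step1 h h2 h3⟩
  · rintro ⟨b, h1, h2, h3⟩
    have key : Relation.ReflTransGen (MR w) x b := by
      clear h3 h2
      induction h1 with
      | refl => exact .refl
      | tail _ h4 ih =>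
        obtain ⟨d, h5, h6, h7⟩ := mq_step2 h h4.1 h4.2
        exact (ih.trans h5).tail ⟨h6, h7⟩
    obtain ⟨d, h5, h6, h7⟩ := mq_step2 h h2 h3
    exact ⟨d, key.trans h5, h6, h7⟩

theorem mp_eqv {w w' : List ℕ} (h : Relation.EqvGen MetaStep w w') (x z k : ℕ) :
    MP w x z k ↔ MP w' x z k := by
  induction h with
  | rel _ _ h => exact mp_step h x z k
  | refl => rfl
  | symm _ _ _ ih => exact ih.symm
  | trans _ _ _ _ _ ih1 ih2 => exact ih1.trans ih2

theorem perm_eqv {w w' : List ℕ} (h : Relation.EqvGen MetaStep w w') : w.Perm w' := by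
  induction h with
  | rel _ _ h =>
    obtain ⟨s, t, p, q, hpq, rfl, rfl, h⟩ := step_form h
    exact List.Perm.append_left _ (List.Perm.swap _ _ _)
  | refl => rfl
  | symm _ _ _ ih => exact ih.symm
  | trans _ _ _ _ _ ih1 ih2 => exact ih1.trans ih2

theorem mq_of_mp {w : List ℕ} (hw : MAv w) {x z k : ℕ} (h : MP w x z k) :
    x < z ∧ MQ w x z k := by
  obtain ⟨b, h1, h2, h3⟩ := h
  induction h1 using Relation.ReflTransGen.head_induction_on with
  | refl => exact ⟨h2, h3⟩
  | @head x b hR _ ih =>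
    obtain ⟨hbz, u, v, huv, hb, hk⟩ := ih
    obtain ⟨hxb, u', v', huv', hx, hk'⟩ := hR
    refine ⟨hxb.trans hbz, ?_⟩
    have hb' : b ∈ u' := List.count_pos_iff.1 hk'
    rcases List.append_eq_append_iff.1 (huv.symm.trans huv') with ⟨m, rfl, rfl⟩ | ⟨m, rfl, rfl⟩
    · exact ⟨u, m ++ v', huv, by simp [hx], hk⟩
    · by_cases hm : z ∈ m
      · exfalso
        apply hw b z hbz
        rw [huv, List.append_assoc]
        have := (List.singleton_sublist.2 hb').append
          ((List.singleton_sublist.2 hm).append (List.singleton_sublist.2 hb))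
        simpa using this
      · refine ⟨u', m ++ v, huv', hx, ?_⟩
        rw [List.count_append, List.count_eq_zero_of_not_mem hm] at hk
        exact hk

theorem mav_tail {x : ℕ} {l : List ℕ} (h : MAv (x :: l)) : MAv l :=
  fun a b hab hs => h a b hab (hs.cons _)

theorem mq_tail {x a c k : ℕ} {l m : List ℕ} (hp : l.Perm m)
    (h : ∀ k, MQ (x :: l) a c k → MQ (x :: m) a c k) (hq : MQ l a c k) : MQ m a c k := by
  obtain ⟨u, v, rfl, ha, hk⟩ := hq
  rcases Nat.eq_zero_or_pos k with rfl | hk0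
  · exact ⟨[], m, rfl, hp.subset (by simp [ha]), by simp⟩
  · obtain ⟨u', v', h1, h2, h3⟩ := h (k + if x = c then 1 else 0)
      ⟨x :: u, v, rfl, ha, by simp [List.count_cons]; omega⟩
    match u', h1 with
    | [], _ => simp at h3; omega
    | y :: u', h1 =>
      simp at h1
      obtain ⟨rfl, rfl⟩ := h1
      exact ⟨u', v', rfl, h2, by simp [List.count_cons] at h3; omega⟩

theorem head_absurd {x y : ℕ} {l m : List ℕ} (hxy : x < y) (hl : MAv (x :: l))
    (hp : (x :: l).Perm (y :: m)) (h : MQ (y :: m) x y 1 → MQ (x :: l) x y 1) : False := by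
  have hx : x ∈ m := by
    have : x ∈ y :: m := hp.subset (by simp)
    simp at this
    rcases this with h | h
    · omega
    · exact h
  obtain ⟨u, v, h1, h2, h3⟩ := h ⟨[y], m, rfl, hx, by simp⟩
  have hy : y ∈ u := List.count_pos_iff.1 h3
  match u, h1 with
  | [], _ => simp at hy
  | z :: u, h1 =>
    simp at h1
    obtain ⟨rfl, rfl⟩ := h1
    have hy : y ∈ u := by
      simp at hy
      rcases hy with h | h
      · omega
      · exact h
    apply hl x y hxy
    have := ((List.singleton_sublist.2 hy).append (List.singleton_sublist.2 h2))
    exact List.Sublist.cons_cons _ (by simpa using this)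

theorem mav_eq (l m : List ℕ) (hl : MAv l) (hm : MAv m) (hp : l.Perm m)
    (h : ∀ a c k, a < c → (MQ l a c k ↔ MQ m a c k)) : l = m := by
  induction l generalizing m with
  | nil => exact (List.nil_perm.1 hp).symm
  | cons x l ih =>
    match m with
    | [] => simp at hp
    | y :: m =>
      rcases lt_trichotomy x y with hxy | rfl | hxy
      · exact (head_absurd hxy hl hp (h _ _ _ hxy).2).elim
      · have hp' := (List.perm_cons x).1 hp
        rw [ih m (mav_tail hl) (mav_tail hm) hp' (fun a c k hac =>
          ⟨mq_tail hp' (fun k => (h a c k hac).1), mq_tail hp'.symm (fun k => (h a c k hac).2)⟩)]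
      · exact (head_absurd hxy hm hp.symm (h _ _ _ hxy).1).elim

theorem mav_eq_of_eqv {l m : List ℕ} (hl : MAv l) (hm : MAv m)
    (h : Relation.EqvGen MetaStep l m) : l = m := by
  refine mav_eq l m hl hm (perm_eqv h) fun a c k hac => ⟨fun h1 => ?_, fun h1 => ?_⟩
  · exact (mq_of_mp hm ((mp_eqv h a c k).1 ⟨a, .refl, hac, h1⟩)).2
  · exact (mq_of_mp hl ((mp_eqv h a c k).2 ⟨a, .refl, hac, h1⟩)).2

theorem step_lt {w w' : List ℕ} (h : MetaStep w w') : w < w' := by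
  obtain ⟨s, t, p, q, hpq, rfl, rfl, -⟩ := step_form h
  clear h
  induction s with
  | nil => exact List.cons_lt_cons_iff.2 (Or.inl hpq)
  | cons x s ih => exact List.cons_lt_cons_iff.2 (Or.inr ⟨rfl, ih⟩)

theorem first_big (a : ℕ) (s : List ℕ) (h : ∃ b ∈ s, a < b) :
    ∃ p b q, s = p ++ b :: q ∧ a < b ∧ ∀ d ∈ p, d ≤ a := by
  induction s with
  | nil => simp at h
  | cons x s ih =>
    by_cases hx : a < x
    · exact ⟨[], x, s, rfl, hx, by simp⟩
    · obtain ⟨p, b, q, rfl, h1, h2⟩ := ih (by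
        obtain ⟨b, hb, hab⟩ := h
        simp at hb
        rcases hb with rfl | hb
        · exact (hx hab).elim
        · exact ⟨b, hb, hab⟩)
      refine ⟨x :: p, b, q, rfl, h1, ?_⟩
      intro d hd
      simp at hd
      rcases hd with rfl | hd
      · omega
      · exact h2 d hd

theorem exists_step {w : List ℕ} (h : ¬ MAv w) : ∃ w', MetaStep w w' := by
  unfold MAv at h
  push Not at h
  obtain ⟨a, b, hab, hs⟩ := h
  obtain ⟨r1, r2, rfl, h1, h2⟩ := List.cons_sublist_iff.1 hs
  obtain ⟨r3, r4, rfl, h3, h4⟩ := List.cons_sublist_iff.1 h2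
  rw [List.singleton_sublist] at h4
  obtain ⟨u, s1, rfl⟩ := List.append_of_mem h1
  obtain ⟨s2, x, rfl⟩ := List.append_of_mem h4
  obtain ⟨p, c, q, hpq, hc, hp⟩ := first_big a (s1 ++ r3 ++ s2) ⟨b, by simp [h3], hab⟩
  have hw : (u ++ a :: s1) ++ (r3 ++ (s2 ++ a :: x)) = u ++ a :: (p ++ c :: q) ++ a :: x := by
    rw [← hpq]; simp
  rw [hw]
  rcases List.eq_nil_or_concat p with rfl | ⟨p', d, rfl⟩
  · exact ⟨_, Or.inl ⟨u, q, x, a, c, hc, by simp, rfl⟩⟩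
  · rcases (hp d (by simp)).eq_or_lt with rfl | hd
    · exact ⟨_, Or.inl ⟨u ++ d :: p', q, x, d, c, hc, by simp, rfl⟩⟩
    · exact ⟨_, Or.inr ⟨u, p', q, x, d, a, c, hd, hc, by simp, rfl⟩⟩

theorem exists_nf (w : List ℕ) : ∃ w', Relation.EqvGen MetaStep w w' ∧ MAv w' := by
  have hfin : {w' | Relation.EqvGen MetaStep w w'}.Finite :=
    (w.permutations.toFinset.finite_toSet).subset (fun w' hw' => by
      simpa using (perm_eqv hw').symm)
  obtain ⟨m, hm⟩ := hfin.exists_maximal ⟨w, .refl w⟩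
  refine ⟨m, hm.1, ?_⟩
  by_contra hc
  obtain ⟨m', h'⟩ := exists_step hc
  have h1 := hm.2 (y := m') (.trans _ _ _ hm.1 (.rel _ _ h')) (step_lt h').le
  exact absurd (step_lt h') (not_lt_of_ge h1)

abbrev MT (n : ℕ) := {w : List ℕ // w.length = n ∧ IsPacked w ∧ MAv w}

theorem card_quot (n : ℕ) : Nat.card
      (Quotient (Setoid.comap
        (Subtype.val : {w : List ℕ // w.length = n ∧ IsPacked w} → List ℕ)
        (Relation.EqvGen.setoid MetaStep))) = Nat.card (MT n) := by
  symm
  refine Nat.card_congr (Equiv.ofBijective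
    (fun w : MT n => Quotient.mk _ ⟨w.1, w.2.1, w.2.2.1⟩) ⟨?_, ?_⟩)
  · intro a b hab
    have h : Relation.EqvGen MetaStep a.1 b.1 := Quotient.exact hab
    exact Subtype.ext (mav_eq_of_eqv a.2.2.2 b.2.2.2 h)
  · intro q
    induction q using Quotient.inductionOn with
    | h w =>
      obtain ⟨w', h1, h2⟩ := exists_nf w.1
      have hp := perm_eqv h1
      refine ⟨⟨w', hp.length_eq.symm.trans w.2.1, ?_, h2⟩, ?_⟩
      · intro k hk
        exact hp.subset (w.2.2 k (hp.symm.subset hk))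
      · exact Quotient.sound (Relation.EqvGen.symm _ _ h1)

/-! ### Counting -/

def mdup : List ℕ → List ℕ
  | [] => []
  | x :: l => if x = 0 then 0 :: 0 :: l else x :: mdup l

def mins (i : ℕ) (w : List ℕ) : List ℕ :=
  (w.map Nat.succ).take i ++ 0 :: (w.map Nat.succ).drop i

theorem mdup_append (s t : List ℕ) (hs : 0 ∉ s) : mdup (s ++ 0 :: t) = s ++ 0 :: 0 :: t := by
  induction s with
  | nil => simp [mdup]
  | cons x s ih =>
    simp at hs
    have : x ≠ 0 := fun h => hs.1 h.symm
    simp [mdup, this, ih hs.2]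

theorem first_zero {w : List ℕ} (h : 0 ∈ w) : ∃ s t, w = s ++ 0 :: t ∧ 0 ∉ s := by
  obtain ⟨s, t, h1, h2⟩ := List.eq_append_cons_of_mem h
  exact ⟨s, t, h1, h2⟩

theorem packed_zero_mem {w : List ℕ} (hw : IsPacked w) (hne : w ≠ []) : 0 ∈ w := by
  obtain ⟨x, hx⟩ := List.exists_mem_of_ne_nil w hne
  induction x with
  | zero => exact hx
  | succ k ih => exact ih (hw k hx)

theorem mdup_erase {w : List ℕ} (h : 0 ∈ w) : (mdup w).erase 0 = w := by
  obtain ⟨s, t, rfl, hs⟩ := first_zero h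
  rw [mdup_append s t hs, List.erase_append_right _ hs]
  simp

theorem mdup_count {w : List ℕ} (h : 0 ∈ w) : 2 ≤ (mdup w).count 0 := by
  obtain ⟨s, t, rfl, hs⟩ := first_zero h
  rw [mdup_append s t hs]
  simp [List.count_cons]; omega

theorem map_succ_nz (w : List ℕ) : 0 ∉ w.map Nat.succ := by simp

theorem mins_nz (i : ℕ) (w : List ℕ) :
    0 ∉ (w.map Nat.succ).take i ∧ 0 ∉ (w.map Nat.succ).drop i :=
  ⟨fun h => map_succ_nz w (List.mem_of_mem_take h), fun h => map_succ_nz w (List.mem_of_mem_drop h)⟩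

theorem mins_erase (i : ℕ) (w : List ℕ) : (mins i w).erase 0 = w.map Nat.succ := by
  unfold mins
  rw [List.erase_append_right _ (mins_nz i w).1]
  simp

theorem mins_count (i : ℕ) (w : List ℕ) : (mins i w).count 0 = 1 := by
  unfold mins
  rw [List.count_append, List.count_cons, List.count_eq_zero_of_not_mem (mins_nz i w).1,
    List.count_eq_zero_of_not_mem (mins_nz i w).2]
  simp

theorem mins_idx (i : ℕ) (w : List ℕ) (hi : i ≤ w.length) : (mins i w).idxOf 0 = i := by
  unfold mins
  rw [List.idxOf_append_of_notMem (mins_nz i w).1]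
  simp [hi]

open List in
theorem sub_mdup (s l : List ℕ) (hs : 0 ∉ s) (h : s <+ mdup l) : s <+ l := by
  have h1 : ∀ l : List ℕ, (mdup l).filter (· ≠ 0) = l.filter (· ≠ 0) := by
    intro l
    induction l with
    | nil => rfl
    | cons x l ih =>
      by_cases hx : x = 0
      · subst hx; simp [mdup]
      · simp [mdup, hx] at ih ⊢; exact ih
  have h2 : s.filter (· ≠ 0) = s := List.filter_eq_self.2 (fun a ha => by
    simp; rintro rfl; exact hs ha)
  have h3 := h.filter (fun x => decide (x ≠ 0))
  rw [h1, h2] at h3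
  exact h3.trans (List.filter_sublist)

theorem mav_mdup {w : List ℕ} (hw : MAv w) : MAv (mdup w) := by
  intro a b hab hs
  rcases Nat.eq_zero_or_pos a with rfl | ha
  · by_cases h0 : 0 ∈ w
    · obtain ⟨s, t, rfl, hz⟩ := first_zero h0
      rw [mdup_append s t hz] at hs
      have key : ∀ s : List ℕ, 0 ∉ s → List.Sublist [0, b, 0] (s ++ 0 :: 0 :: t) →
          List.Sublist [0, b, 0] (s ++ 0 :: t) := by
        intro s h0 hs
        induction s with
        | nil =>
          cases hs with
          | cons _ h => exact h
          | cons_cons _ h =>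
            cases h with
            | cons _ h => exact h.cons_cons _
            | cons_cons _ h => omega
        | cons x s ih =>
          simp at h0
          cases hs with
          | cons _ h => exact (ih h0.2 h).cons _
          | cons_cons _ h => simp at h0
      exact hw 0 b hab (key s hz hs)
    · have : mdup w = w := by
        clear hw hs
        induction w with
        | nil => rfl
        | cons x l ih =>
          simp at h0
          have hx : x ≠ 0 := fun h => h0.1 h.symm
          simp [mdup, hx, ih h0.2]
      rw [this] at hs
      exact hw 0 b hab hs
  · exact hw a b hab (sub_mdup _ _ (by simp; omega) hs)

theorem mav_mins {w : List ℕ} (i : ℕ) (hw : MAv w) : MAv (mins i w) := by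
  intro a b hab hs
  rcases Nat.eq_zero_or_pos a with rfl | ha
  · have h1 := hs.count_le 0
    rw [mins_count] at h1
    simp [List.count_cons] at h1
  · have h1 := hs.erase 0
    rw [mins_erase, List.erase_of_not_mem (by simp; omega)] at h1
    have h2 := h1.map Nat.pred
    rw [List.map_map] at h2
    have h3 : (Nat.pred ∘ Nat.succ) = id := by funext x; simp
    rw [h3, List.map_id] at h2
    exact hw (a - 1) (b - 1) (by omega) h2

theorem mem_mins (i x : ℕ) (w : List ℕ) : x ∈ mins i w ↔ x = 0 ∨ x ∈ w.map Nat.succ := by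
  conv_rhs => rw [← List.take_append_drop i (w.map Nat.succ)]
  unfold mins
  simp only [List.mem_append, List.mem_cons]
  tauto

theorem packed_mins {w : List ℕ} (i : ℕ) (hw : IsPacked w) : IsPacked (mins i w) := by
  intro k hk
  rw [mem_mins] at hk ⊢
  simp at hk
  rcases k with _ | k
  · simp
  · right
    simpa using hw k hk

theorem packed_mdup {w : List ℕ} (hw : IsPacked w) (h : 0 ∈ w) : IsPacked (mdup w) := by
  obtain ⟨s, t, rfl, hs⟩ := first_zero h
  rw [mdup_append s t hs]
  intro k hk
  have := hw k (by simpa using hk)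
  simpa using this

theorem mdup_length {w : List ℕ} (h : 0 ∈ w) : (mdup w).length = w.length + 1 := by
  obtain ⟨s, t, rfl, hs⟩ := first_zero h
  rw [mdup_append s t hs]
  simp; omega

theorem mins_length {w : List ℕ} (i : ℕ) (hi : i ≤ w.length) :
    (mins i w).length = w.length + 1 := by
  unfold mins
  simp; omega

theorem MT_zero {n : ℕ} (hn : 1 ≤ n) (w : MT n) : 0 ∈ w.1 :=
  packed_zero_mem w.2.2.1 (by rintro h; have := w.2.1; rw [h] at this; simp at this; omega)

def mfun (n : ℕ) (hn : 1 ≤ n) : MT n × Option (Fin (n + 1)) → MT (n + 1)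
  | (w, none) => ⟨mdup w.1, by rw [mdup_length (MT_zero hn w), w.2.1],
      packed_mdup w.2.2.1 (MT_zero hn w), mav_mdup w.2.2.2⟩
  | (w, some i) => ⟨mins i w.1, by rw [mins_length _ (by have := w.2.1; omega), w.2.1],
      packed_mins _ w.2.2.1, mav_mins _ w.2.2.2⟩

theorem mfun_inj (n : ℕ) (hn : 1 ≤ n) : Function.Injective (mfun n hn) := by
  rintro ⟨w, i⟩ ⟨w', j⟩ h
  have h := congrArg Subtype.val h
  rcases i with _ | i <;> rcases j with _ | j <;> simp only [mfun] at h
  · have h1 := congrArg (fun l => l.erase 0) h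
    simp only [mdup_erase (MT_zero hn w), mdup_erase (MT_zero hn w')] at h1
    rw [Subtype.ext h1]
  · have h1 := mdup_count (MT_zero hn w)
    rw [h, mins_count] at h1
    omega
  · have h1 := mdup_count (MT_zero hn w')
    rw [← h, mins_count] at h1
    omega
  · have h1 := congrArg (fun l => l.erase 0) h
    simp only [mins_erase] at h1
    have h2 := List.map_injective_iff.2 Nat.succ_injective h1
    have h3 := congrArg (fun l => l.idxOf 0) h
    rw [mins_idx _ _ (by have := w.2.1; omega), mins_idx _ _ (by have := w'.2.1; omega)] at h3
    rw [Subtype.ext h2, Fin.ext h3]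

theorem mfun_surj (n : ℕ) (hn : 1 ≤ n) : Function.Surjective (mfun n hn) := by
  rintro ⟨w, hl, hp, ha⟩
  have h0 : 0 ∈ w := packed_zero_mem hp (by rintro rfl; simp at hl)
  obtain ⟨s, t, rfl, hs⟩ := first_zero h0
  by_cases ht : 0 ∈ t
  · have : ∃ t', t = 0 :: t' := by
      rcases t with _ | ⟨y, t'⟩
      · simp at ht
      · rcases Nat.eq_zero_or_pos y with rfl | hy
        · exact ⟨t', rfl⟩
        · exfalso
          apply ha 0 y hy
          have h1 : 0 ∈ t' := by
            simp at ht
            rcases ht with h | h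
            · omega
            · exact h
          exact (((List.singleton_sublist.2 h1).cons_cons y).cons_cons 0).trans
            (List.sublist_append_right _ _)
    obtain ⟨t', rfl⟩ := this
    refine ⟨(⟨s ++ 0 :: t', ?_, ?_, ?_⟩, none), ?_⟩
    · simp at hl ⊢; omega
    · intro k hk
      have := hp k (by simpa using hk)
      simpa using this
    · intro a b hab h
      exact ha a b hab (h.trans (List.Sublist.append_left (List.sublist_cons_self _ _) _))
    · exact Subtype.ext (mdup_append s t' hs)
  · have hsucc : ((s ++ t).map Nat.pred).map Nat.succ = s ++ t := by
      rw [List.map_map]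
      conv_rhs => rw [← List.map_id (s ++ t)]
      apply List.map_congr_left
      intro x hx
      have : x ≠ 0 := by
        rintro rfl
        simp at hx
        tauto
      simp; omega
    refine ⟨(⟨(s ++ t).map Nat.pred, ?_, ?_, ?_⟩, some ⟨s.length, ?_⟩), ?_⟩
    · simp at hl ⊢; omega
    · intro k hk
      have h1 : k + 1 + 1 ∈ s ++ t := by
        rw [← hsucc]; exact List.mem_map_of_mem (f := Nat.succ) hk
      have h2 := hp (k + 1) (by simp at h1 ⊢; tauto)
      have h3 : k + 1 ∈ s ++ t := by simpa using h2
      exact List.mem_map.2 ⟨k + 1, h3, rfl⟩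
    · intro a b hab h
      have h1 := h.map Nat.succ
      rw [hsucc] at h1
      exact ha (a + 1) (b + 1) (by omega)
        (h1.trans (List.Sublist.append_left (List.sublist_cons_self _ _) _))
    · simp at hl; omega
    · apply Subtype.ext
      simp only [mfun, mins]
      rw [hsucc]
      simp

theorem card_MT (n : ℕ) (hn : 1 ≤ n) : Nat.card (MT n) = Nat.factorial (n + 1) / 2 := by
  induction n, hn using Nat.le_induction with
  | base =>
    have : Nat.card (MT 1) = 1 := by
      rw [Nat.card_eq_one_iff_unique]
      refine ⟨⟨fun a b => ?_⟩, ⟨⟨[0], rfl, ?_, ?_⟩⟩⟩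
      · have key : ∀ w : MT 1, w.1 = [0] := by
          intro w
          have h0 := MT_zero le_rfl w
          obtain ⟨x, hx⟩ := List.length_eq_one_iff.1 w.2.1
          rw [hx] at h0 ⊢
          simp at h0
          rw [← h0]
        exact Subtype.ext ((key a).trans (key b).symm)
      · intro k hk; simp at hk
      · intro a b hab h
        have := h.length_le
        simp at this
    rw [this]; rfl
  | succ n hn ih =>
    rw [← Nat.card_congr (Equiv.ofBijective _ ⟨mfun_inj n hn, mfun_surj n hn⟩), Nat.card_prod, ih,
      Nat.factorial_succ (n + 1), Nat.mul_div_assoc _ (Nat.dvd_factorial (by norm_num) (by omega)),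
      Nat.card_eq_fintype_card, Fintype.card_option, Fintype.card_fin, mul_comm]

/-- The number of metasylvester classes of packed words of length `n`
is `(n+1)!/2` for `n ≥ 1`. -/
theorem card_metasylvester_classes_packedWords (n : ℕ) (hn : 1 ≤ n) :
    Nat.card
      (Quotient (Setoid.comap
        (Subtype.val : {w : List ℕ // w.length = n ∧ IsPacked w} → List ℕ)
        (Relation.EqvGen.setoid MetaStep))) =
      Nat.factorial (n + 1) / 2 := by
  rw [card_quot, card_MT n hn]
end

section
/- The generating function X(t) of the number of hyposylvester classes of m-parking functions of length n satisfies the algebraic equation X = 1 + t X^{2m+1}; hence the number of hyposylvester classes of m-parking functions of length n equals the number of (2m+1)-ary trees with n internal nodes, (1/((2m)n+1)) binomial((2m+1)n, n). -/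
/-- One elementary hyposylvester rewriting. -/
def HypoStep {α : Type*} [LinearOrder α] (w w' : List α) : Prop :=
  (∃ (u v : List α) (a c : α), a < c ∧
      (∃ b ∈ u ++ [a, c] ++ v, a < b ∧ b < c) ∧
      w = u ++ [a, c] ++ v ∧ w' = u ++ [c, a] ++ v) ∨
  (∃ (u v x : List α) (a b : α), a < b ∧
      w = u ++ [a, b] ++ v ++ [a] ++ x ∧ w' = u ++ [b, a] ++ v ++ [a] ++ x)

/-- An `m`-parking function: a word of positive integers whose nondecreasing
rearrangement `b₁ ≤ ⋯ ≤ b_n` satisfies `b_i ≤ m(i−1)+1`; equivalently, for every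
`1 ≤ i ≤ n` at least `i` letters are `≤ m(i−1)+1`. -/
def IsMParkingFunction (m : ℕ) (w : List ℕ) : Prop :=
  (∀ a ∈ w, 1 ≤ a) ∧
  ∀ i : ℕ, 1 ≤ i → i ≤ w.length →
    i ≤ (w.filter (fun a => a ≤ m * (i - 1) + 1)).length

/-- The number of hyposylvester classes of `m`-parking functions of length `n`. -/
noncomputable def hypoParkCount (m n : ℕ) : ℕ :=
  Nat.card
    (Quotient (Setoid.comap
      (Subtype.val : {w : List ℕ // w.length = n ∧ IsMParkingFunction m w} → List ℕ)
      (Relation.EqvGen.setoid HypoStep)))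

abbrev HypoEqv {α : Type*} [LinearOrder α] (w w' : List α) : Prop := Relation.EqvGen HypoStep w w'

theorem HypoStep.ctx {w w' : List ℕ} (h : HypoStep w w') (p q : List ℕ) :
    HypoStep (p ++ w ++ q) (p ++ w' ++ q) := by
  rcases h with ⟨u, v, a, c, hac, ⟨b, hb, h1⟩, rfl, rfl⟩ | ⟨u, v, x, a, b, hab, rfl, rfl⟩
  · left
    refine ⟨p ++ u, v ++ q, a, c, hac, ⟨b, ?_, h1⟩, by simp, by simp⟩
    simp at hb ⊢; tauto
  · right
    exact ⟨p ++ u, v, x ++ q, a, b, hab, by simp, by simp⟩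

theorem HypoEqv.ctx {w w' : List ℕ} (h : HypoEqv w w') (p q : List ℕ) :
    HypoEqv (p ++ w ++ q) (p ++ w' ++ q) := by
  induction h with
  | rel x y h => exact .rel _ _ (h.ctx p q)
  | refl x => exact .refl _
  | symm x y _ ih => exact .symm _ _ ih
  | trans x y z _ _ h1 h2 => exact .trans _ _ _ h1 h2

theorem HypoStep.perm {w w' : List ℕ} (h : HypoStep w w') : w.Perm w' := by
  rcases h with ⟨u, v, a, c, hac, ⟨b, hb, h1⟩, rfl, rfl⟩ | ⟨u, v, x, a, b, hab, rfl, rfl⟩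
  · exact ((List.Perm.swap c a []).append_left u).append_right v
  · exact ((((List.Perm.swap b a []).append_left u).append_right v).append_right [a]).append_right x

theorem HypoEqv.perm {w w' : List ℕ} (h : HypoEqv w w') : w.Perm w' := by
  induction h with
  | rel x y h => exact h.perm
  | refl x => exact .refl _
  | symm x y _ ih => exact ih.symm
  | trans x y z _ _ h1 h2 => exact h1.trans h2

/-- number of `j` in the word with no later `i` -/
def cnt (i j : ℕ) : List ℕ → ℕ
  | [] => 0
  | x :: w => cnt i j w + if i ∉ w ∧ x = j then 1 else 0

theorem cnt_append (i j : ℕ) (u v : List ℕ) :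
    cnt i j (u ++ v) = cnt i j v + if i ∈ v then 0 else cnt i j u := by
  induction u with
  | nil => simp [cnt]
  | cons x u ih =>
    simp only [List.cons_append, cnt, ih, List.mem_append]
    split_ifs <;> first | omega | (exfalso; tauto)

theorem cnt_swap {i j a c : ℕ} (hij : i < j) (hac : a < c) (u v : List ℕ)
    (h : a = i → c = j → i ∈ v) : cnt i j (u ++ [a, c] ++ v) = cnt i j (u ++ [c, a] ++ v) := by
  rw [cnt_append, cnt_append i j _ v, cnt_append, cnt_append i j u [c, a]]
  congr 1
  by_cases hv : i ∈ v
  · simp [hv]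
  · simp only [hv, if_false]
    have e : (i ∈ [a, c]) = (i ∈ [c, a]) := by simp [or_comm]
    simp only [e]
    congr 1
    simp only [cnt, List.mem_singleton, List.not_mem_nil]
    split_ifs <;> first | omega | (exfalso; grind)

theorem HypoStep.cnt_eq {w w' : List ℕ} (h : HypoStep w w') {i j : ℕ} (hij : i < j)
    (hw : ∀ b ∈ w, ¬ (i < b ∧ b < j)) : cnt i j w = cnt i j w' := by
  rcases h with ⟨u, v, a, c, hac, ⟨b, hb, h1⟩, rfl, rfl⟩ | ⟨u, v, x, a, b, hab, rfl, rfl⟩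
  · refine cnt_swap hij hac u v ?_
    rintro rfl rfl
    exact absurd h1 (hw b hb)
  · have := cnt_swap hij hab u (v ++ [a] ++ x) (by rintro rfl _; simp)
    simpa using this

theorem HypoEqv.cnt_eq {w w' : List ℕ} (h : HypoEqv w w') {i j : ℕ} (hij : i < j) :
    (∀ b ∈ w, ¬ (i < b ∧ b < j)) → cnt i j w = cnt i j w' := by
  induction h with
  | rel x y h => exact h.cnt_eq hij
  | refl x => intro _; rfl
  | symm x y h ih =>
    intro hw
    exact (ih (fun b hb => hw b ((HypoEqv.perm h).mem_iff.1 hb))).symm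
  | trans x y z h h' h1 h2 =>
    intro hw
    exact (h1 hw).trans (h2 (fun b hb => hw b ((HypoEqv.perm h).mem_iff.2 hb)))

theorem bubbleR {P M : ℕ} (hPM : P < M) (f : List ℕ) : ∀ (u v : List ℕ), P ∈ u →
    (∀ z ∈ f, z < P) → HypoEqv (u ++ [M] ++ f ++ v) (u ++ f ++ [M] ++ v) := by
  induction f with
  | nil => intro u v _ _; simpa using Relation.EqvGen.refl _
  | cons z f ih =>
    intro u v hu hf
    have hz := hf z (by simp)
    have s : HypoStep (u ++ [z, M] ++ (f ++ v)) (u ++ [M, z] ++ (f ++ v)) :=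
      Or.inl ⟨u, f ++ v, z, M, by omega, ⟨P, by simp [hu], hz, hPM⟩, rfl, rfl⟩
    have h2 := ih (u ++ [z]) v (by simp [hu]) (fun y hy => hf y (by simp [hy]))
    refine .trans _ (u ++ [z, M] ++ (f ++ v)) _ (.symm _ _ (.rel _ _ ?_)) ?_
    · simpa using s
    · simpa using h2

theorem moveR {P M : ℕ} (hPM : P < M) (y : List ℕ) : ∀ (u : List ℕ), P ∈ u →
    (∀ z ∈ y, z < P ∨ z = M) →
    HypoEqv (u ++ y) (u ++ y.filter (· ≠ M) ++ List.replicate (y.count M) M) := by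
  induction y with
  | nil => intro u _ _; simpa using Relation.EqvGen.refl _
  | cons z y ih =>
    intro u hu hy
    have hy' : ∀ z ∈ y, z < P ∨ z = M := fun x hx => hy x (by simp [hx])
    have h1 := ih (u ++ [z]) (by simp [hu]) hy'
    by_cases hz : z = M
    · subst hz
      have h2 := bubbleR hPM (y.filter (· ≠ z)) u (List.replicate (y.count z) z) hu (by
        intro x hx
        simp at hx
        rcases hy' x hx.1 with h | h
        · exact h
        · exact absurd h hx.2)
      have h3 := Relation.EqvGen.trans _ _ _ h1 h2
      simpa [List.replicate_succ] using h3
    · simpa [hz] using h1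

theorem bubbleL {P M z : ℕ} (hPM : P < M) (hz : z ≤ P) (v : List ℕ) (hv : P ∈ v) (p : ℕ) :
    HypoEqv ([z] ++ List.replicate p M ++ v) (List.replicate p M ++ [z] ++ v) := by
  induction p with
  | zero => simpa using Relation.EqvGen.refl _
  | succ p ih =>
    have s : HypoStep ([z, M] ++ List.replicate p M ++ v) ([M, z] ++ List.replicate p M ++ v) := by
      rcases Nat.eq_or_lt_of_le hz with h | h
      · subst h
        obtain ⟨s, t, rfl⟩ := List.append_of_mem hv
        exact Or.inr ⟨[], List.replicate p M ++ s, t, z, M, hPM, by simp, by simp⟩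
      · exact Or.inl ⟨[], List.replicate p M ++ v, z, M, by omega, ⟨P, by simp [hv], h, hPM⟩,
          by simp, by simp⟩
    refine .trans _ _ _ (.rel _ _ (?_ : HypoStep _ ([M, z] ++ List.replicate p M ++ v))) ?_
    · simpa [List.replicate_succ] using s
    · simpa [List.replicate_succ] using ih.ctx [M] []

theorem moveL {P M : ℕ} (hPM : P < M) (v : List ℕ) (hv : P ∈ v) (x : List ℕ)
    (hx : ∀ z ∈ x, z ≤ P ∨ z = M) :
    HypoEqv (x ++ v) (List.replicate (x.count M) M ++ x.filter (· ≠ M) ++ v) := by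
  induction x with
  | nil => simpa using Relation.EqvGen.refl _
  | cons z x ih =>
    have h1 := (ih (fun y hy => hx y (by simp [hy]))).ctx [z] []
    by_cases hz : z = M
    · subst hz
      simpa [List.replicate_succ] using h1
    · have h2 := bubbleL hPM ((hx z (by simp)).resolve_right hz) (x.filter (· ≠ M) ++ v)
        (by simp [hv]) (x.count M)
      refine .trans _ _ _ (?_ : HypoEqv _ ([z] ++ List.replicate (x.count M) M ++ (x.filter (· ≠ M) ++ v))) ?_
      · simpa using h1
      · simpa [hz] using h2

theorem exists_last {P : ℕ} (w : List ℕ) (h : P ∈ w) : ∃ x y, w = x ++ P :: y ∧ P ∉ y := by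
  induction w with
  | nil => simp at h
  | cons z w ih =>
    by_cases hw : P ∈ w
    · obtain ⟨x, y, rfl, hy⟩ := ih hw
      exact ⟨z :: x, y, rfl, hy⟩
    · have : P = z := by simpa [hw] using h
      exact ⟨[], w, by simp [this], hw⟩

theorem move {P M : ℕ} (hPM : P < M) (w : List ℕ) (hP : P ∈ w) (h : ∀ z ∈ w, z ≤ P ∨ z = M) :
    ∃ p k, HypoEqv w (List.replicate p M ++ w.filter (· ≠ M) ++ List.replicate k M) := by
  obtain ⟨x, y, rfl, hy⟩ := exists_last w hP
  refine ⟨x.count M, y.count M, ?_⟩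
  have h1 := moveL hPM (P :: y) (by simp) x (fun z hz => h z (by simp [hz]))
  have h2 := moveR hPM y (List.replicate (x.count M) M ++ x.filter (· ≠ M) ++ [P]) (by simp) (by
    intro z hz
    rcases h z (by simp [hz]) with h | h
    · left; exact lt_of_le_of_ne h (by rintro rfl; exact hy hz)
    · exact Or.inr h)
  have hne : P ≠ M := hPM.ne
  refine .trans _ _ _ h1 ?_
  simpa [hne] using h2

def Phi (b : List ℕ) : List ℕ :=
  ((b.filter (fun x => x % 2 = 1)).reverse ++ b.filter (fun x => x % 2 = 0)).map (fun x => x / 2 + 1)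

theorem Phi_perm (b : List ℕ) : (Phi b).Perm (b.map (fun x => x / 2 + 1)) := by
  apply List.Perm.map
  refine ((List.reverse_perm _).append_right _).trans ?_
  have := List.filter_append_perm (fun x => decide (x % 2 = 1)) b
  convert this using 2
  apply List.filter_congr
  intro x _
  rcases Nat.mod_two_eq_zero_or_one x with h | h <;> simp [h]

theorem exists_nf_s15 (n : ℕ) : ∀ w : List ℕ, w.length = n → (∀ x ∈ w, 1 ≤ x) →
    ∃ b : List ℕ, b.Pairwise (· ≤ ·) ∧ (∀ x ∈ b, 1 ≤ x) ∧ HypoEqv w (Phi b) := by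
  induction n using Nat.strong_induction_on with
  | _ n ih =>
    intro w hn hw
    by_cases hnil : w = []
    · subst hnil
      exact ⟨[], by simp, by simp, .refl _⟩
    obtain ⟨M, hM⟩ : ∃ M, M ∈ w ∧ ∀ x ∈ w, x ≤ M := by
      obtain ⟨M, h1, h2⟩ := Finset.exists_max_image w.toFinset id (by simpa using hnil)
      exact ⟨M, by simpa using h1, fun x hx => h2 x (by simpa using hx)⟩
    have hM1 := hw M hM.1
    set w' := w.filter (· ≠ M) with hw'
    by_cases hnil' : w' = []
    · have hall : ∀ x ∈ w, x = M := by
        intro x hx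
        by_contra hne
        have : x ∈ w' := by simp [hw', hx, hne]
        simp [hnil'] at this
      have : w = List.replicate n M := List.eq_replicate_iff.2 ⟨hn, hall⟩
      refine ⟨List.replicate n (2 * M - 1), ?_, ?_, ?_⟩
      · simp [List.pairwise_replicate]
      · intro x hx
        have := List.eq_of_mem_replicate hx
        omega
      · have e1 : (2 * M - 1) % 2 = 1 := by omega
        have e2 : (2 * M - 1) / 2 + 1 = M := by omega
        have : Phi (List.replicate n (2 * M - 1)) = w := by
          simp [Phi, e1, e2, this]
        rw [this]; exact .refl _
    · obtain ⟨P, hP⟩ : ∃ P, P ∈ w' ∧ ∀ x ∈ w', x ≤ P := by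
        obtain ⟨P, h1, h2⟩ := Finset.exists_max_image w'.toFinset id (by simpa using hnil')
        exact ⟨P, by simpa using h1, fun x hx => h2 x (by simpa using hx)⟩
      have hPw : P ∈ w ∧ P ≠ M := by simpa [hw'] using hP.1
      have hPM : P < M := lt_of_le_of_ne (hM.2 P hPw.1) hPw.2
      obtain ⟨p, k, hpk⟩ := move hPM w hPw.1 (by
        intro z hz
        by_cases hzM : z = M
        · exact Or.inr hzM
        · exact Or.inl (hP.2 z (by simp [hw', hz, hzM])))
      have hlen : w'.length < n := by
        rw [← hn, hw', List.length_filter_lt_length_iff_exists]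
        exact ⟨M, hM.1, by simp⟩
      obtain ⟨b, hb1, hb2, hb3⟩ := ih _ hlen w' rfl (fun x hx => hw x (List.mem_of_mem_filter hx))
      have hbM : ∀ x ∈ b, x < 2 * M - 2 := by
        intro x hx
        have h1 : x / 2 + 1 ∈ w' := by
          rw [(hb3.perm.trans (Phi_perm b)).mem_iff]
          exact List.mem_map.2 ⟨x, hx, rfl⟩
        have := hP.2 _ h1
        omega
      have hP1 := hw P hPw.1
      refine ⟨b ++ (List.replicate k (2 * M - 2) ++ List.replicate p (2 * M - 1)), ?_, ?_, ?_⟩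
      · rw [List.pairwise_append, List.pairwise_append]
        refine ⟨hb1, ⟨by simp [List.pairwise_replicate], by simp [List.pairwise_replicate], ?_⟩, ?_⟩
        · intro x hx y hy
          rw [List.eq_of_mem_replicate hx, List.eq_of_mem_replicate hy]; omega
        · intro x hx y hy
          have := hbM x hx
          rcases List.mem_append.1 hy with hy | hy <;> rw [List.eq_of_mem_replicate hy] <;> omega
      · intro x hx
        rcases List.mem_append.1 hx with hx | hx
        · exact hb2 x hx
        · rcases List.mem_append.1 hx with hy | hy <;> rw [List.eq_of_mem_replicate hy] <;> omega
      · have e1 : (2 * M - 1) % 2 = 1 := by omega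
        have e2 : (2 * M - 1) / 2 + 1 = M := by omega
        have e3 : (2 * M - 2) % 2 = 0 := by omega
        have e4 : (2 * M - 2) / 2 + 1 = M := by omega
        have : Phi (b ++ (List.replicate k (2 * M - 2) ++ List.replicate p (2 * M - 1))) =
            List.replicate p M ++ Phi b ++ List.replicate k M := by
          simp [Phi, e1, e2, e3, e4]
        rw [this]
        exact .trans _ _ _ hpk (hb3.ctx _ _)

theorem cnt_asc {i j : ℕ} (hij : i < j) (l : List ℕ) (h : l.Pairwise (· ≤ ·)) :
    cnt i j l = l.count j := by
  induction l with
  | nil => simp [cnt]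
  | cons x l ih =>
    rw [List.pairwise_cons] at h
    rw [cnt, ih h.2, List.count_cons]
    by_cases hx : x = j
    · have : i ∉ l := fun hi => by have := h.1 i hi; omega
      simp [hx, this]
    · simp [hx]

theorem cnt_desc {i j : ℕ} (hij : i < j) (l : List ℕ) (h : l.Pairwise (· ≥ ·)) (hi : i ∈ l) :
    cnt i j l = 0 := by
  induction l with
  | nil => simp [cnt]
  | cons x l ih =>
    rw [List.pairwise_cons] at h
    rw [cnt]
    by_cases hl : i ∈ l
    · simp [ih h.2 hl, hl]
    · have hx : i = x := by simpa [hl] using hi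
      subst hx
      have hne : ¬ i = j := hij.ne
      have hj : j ∉ l := fun hj => by have := h.1 j hj; omega
      simp only [hne, and_false, if_false, add_zero]
      clear ih hi h hl
      induction l with
      | nil => simp [cnt]
      | cons y l ih =>
        simp at hj
        simp [cnt, ih hj.2, Ne.symm hj.1]

theorem count_half (b : List ℕ) (e j : ℕ) (he : e < 2) :
    ((b.filter (fun x => x % 2 = e)).map (fun x => x / 2 + 1)).count (j + 1) = b.count (2 * j + e) := by
  induction b with
  | nil => simp
  | cons x b ih =>
    rw [List.count_cons, ← ih]
    by_cases hx : x % 2 = e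
    · rw [List.filter_cons_of_pos (by simpa using hx), List.map_cons, List.count_cons]
      congr 1
      simp only [beq_iff_eq]
      congr 1
      simp only [eq_iff_iff]
      omega
    · rw [List.filter_cons_of_neg (by simpa using hx)]
      have : ¬ x = 2 * j + e := by omega
      simp [this]

theorem cnt_Phi {i j : ℕ} (hij : i < j + 1) (b : List ℕ) (h : b.Pairwise (· ≤ ·)) (hi : i ∈ Phi b) :
    cnt i (j + 1) (Phi b) = b.count (2 * j) := by
  have mono : ∀ {a b : ℕ}, a ≤ b → a / 2 + 1 ≤ b / 2 + 1 := by intro a b h; omega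
  rw [Phi, List.map_append, List.mem_append] at hi
  rw [Phi, List.map_append, cnt_append, cnt_asc hij]
  · rw [count_half b 0 j (by norm_num), add_zero]
    split_ifs with hi'
    · rfl
    · rw [cnt_desc hij _ _ (hi.resolve_right hi'), add_zero]
      rw [List.pairwise_map, List.pairwise_reverse]
      exact (h.filter _).imp mono
  · rw [List.pairwise_map]
    exact (h.filter _).imp mono

theorem count_Phi (b : List ℕ) (j : ℕ) :
    (Phi b).count (j + 1) = b.count (2 * j + 1) + b.count (2 * j) := by
  rw [Phi, List.map_append, List.count_append, List.map_reverse, List.count_reverse,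
    count_half b 1 j (by norm_num), count_half b 0 j (by norm_num), add_zero]

theorem Phi_inj {b b' : List ℕ} (hb : b.Pairwise (· ≤ ·)) (hb' : b'.Pairwise (· ≤ ·))
    (h0 : 0 ∉ b) (h0' : 0 ∉ b') (h1 : b ≠ [] → 1 ∈ b) (h : HypoEqv (Phi b) (Phi b')) : b = b' := by
  have hp := h.perm
  have hev : ∀ j, b.count (2 * j) = b'.count (2 * j) := by
    intro j
    rcases Nat.eq_zero_or_pos j with rfl | hj
    · simp [List.count_eq_zero_of_not_mem h0, List.count_eq_zero_of_not_mem h0']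
    by_cases hjm : j + 1 ∈ Phi b
    · have hne : b ≠ [] := by rintro rfl; simp [Phi] at hjm
      have h1m : 1 ∈ Phi b := (Phi_perm b).mem_iff.2 (List.mem_map.2 ⟨1, h1 hne, rfl⟩)
      obtain ⟨i, hi, hmax⟩ := Finset.exists_max_image ((Phi b).toFinset.filter (· < j + 1)) id
        ⟨1, by simp [h1m]; omega⟩
      have hi' : i ∈ Phi b ∧ i < j + 1 := by simpa using hi
      have := h.cnt_eq hi'.2 (by
        rintro c hc ⟨hc1, hc2⟩
        have := hmax c (by simp only [Finset.mem_filter, List.mem_toFinset]; exact ⟨hc, hc2⟩)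
        simp at this; omega)
      rwa [cnt_Phi hi'.2 b hb hi'.1, cnt_Phi hi'.2 b' hb' (hp.mem_iff.1 hi'.1)] at this
    · have e1 := List.count_eq_zero_of_not_mem hjm
      have e2 := hp.count_eq (j + 1)
      rw [count_Phi] at e1 e2
      rw [count_Phi] at e2
      omega
  refine List.Perm.eq_of_pairwise' hb hb' (List.perm_iff_count.2 ?_)
  intro x
  obtain ⟨j, hj | hj⟩ := Nat.even_or_odd' x
  · rw [hj, hev]
  · have e2 := hp.count_eq (j + 1)
    rw [count_Phi, count_Phi, hev] at e2
    rw [hj]; omega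

theorem sorted_count (l : List ℕ) (h : l.Pairwise (· ≤ ·)) (c i : ℕ) (hi : i < l.length) :
    l[i] ≤ c ↔ i + 1 ≤ (l.filter (fun a => a ≤ c)).length := by
  induction l generalizing i with
  | nil => simp at hi
  | cons x l ih =>
    rw [List.pairwise_cons] at h
    by_cases hx : x ≤ c
    · rw [List.filter_cons_of_pos (by simpa using hx)]
      cases i with
      | zero => simp [hx]
      | succ i =>
        have := ih h.2 i (by simpa using hi)
        simp only [List.getElem_cons_succ, List.length_cons, this]; omega
    · rw [List.filter_cons_of_neg (by simpa using hx)]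
      have : l.filter (fun a => a ≤ c) = [] := by
        rw [List.filter_eq_nil_iff]
        intro y hy
        have := h.1 y hy
        simp; omega
      rw [this]
      have hle : x ≤ (x :: l)[i] := by
        cases i with
        | zero => simp
        | succ i => simpa using h.1 _ (List.getElem_mem _)
      simp; omega

theorem IsMParkingFunction.perm {m : ℕ} {w w' : List ℕ} (h : w.Perm w')
    (hw : IsMParkingFunction m w) : IsMParkingFunction m w' := by
  refine ⟨fun a ha => hw.1 a (h.mem_iff.2 ha), fun i h1 h2 => ?_⟩
  rw [← (h.filter _).length_eq]
  exact hw.2 i h1 (by rwa [h.length_eq])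

theorem Phi_length (b : List ℕ) : (Phi b).length = b.length := by
  simpa using (Phi_perm b).length_eq

theorem Phi_parking (m : ℕ) (b : List ℕ) (hb : b.Pairwise (· ≤ ·)) :
    IsMParkingFunction m (Phi b) ↔ ∀ i (h : i < b.length), b[i] ≤ 2 * m * i + 1 := by
  have key : ∀ i, ((Phi b).filter (fun a => a ≤ m * i + 1)).length =
      (b.filter (fun a => a ≤ 2 * m * i + 1)).length := by
    intro i
    rw [((Phi_perm b).filter _).length_eq, List.filter_map, List.length_map]
    congr 1
    apply List.filter_congr
    intro x _
    simp only [Function.comp, decide_eq_decide]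
    rw [mul_assoc]; omega
  constructor
  · rintro ⟨_, h⟩ i hi
    rw [sorted_count b hb, ← key]
    have := h (i + 1) (by omega) (by rw [Phi_length]; omega)
    simpa using this
  · intro h
    refine ⟨?_, ?_⟩
    · intro a ha
      obtain ⟨x, _, rfl⟩ := List.mem_map.1 ((Phi_perm b).mem_iff.1 ha)
      omega
    · intro i h1 h2
      rw [Phi_length] at h2
      rw [key]
      have := (sorted_count b hb (2 * m * (i - 1) + 1) (i - 1) (by omega)).1 (h _ _)
      omega
def fL (M : ℕ) : ℕ → ℕ → ℕ
  | 0, _ => 1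
  | _ + 1, 0 => 0
  | n + 1, r + 1 => fL M n (r + 1 + M) + fL M (n + 1) r

def fT (M : ℕ) : ℕ → ℕ → Finset (List ℕ)
  | 0, _ => {[]}
  | _ + 1, 0 => ∅
  | n + 1, r + 1 => (fT M n (r + 1 + M)).image (List.cons 1) ∪
      (fT M (n + 1) r).image (List.map (· + 1))

theorem mem_fT (M n r : ℕ) : ∀ l : List ℕ, l ∈ fT M n r ↔
    l.Pairwise (· ≤ ·) ∧ l.length = n ∧ (∀ x ∈ l, 1 ≤ x) ∧
      ∀ i (h : i < l.length), l[i] ≤ M * i + r := by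
  induction n, r using fL.induct M with
  | case1 r =>
    intro l
    simp only [fT, Finset.mem_singleton]
    constructor
    · rintro rfl; simp
    · rintro ⟨_, h, _⟩; exact List.length_eq_zero_iff.1 h
  | case2 n =>
    intro l
    simp only [fT, Finset.notMem_empty, false_iff]
    rintro ⟨_, h, h1, h2⟩
    have := h2 0 (by omega)
    have := h1 l[0] (List.getElem_mem _)
    omega
  | case3 n r ih1 ih2 =>
    intro l
    simp only [fT, Finset.mem_union, Finset.mem_image]
    constructor
    · rintro (⟨a, ha, rfl⟩ | ⟨a, ha, rfl⟩)
      · obtain ⟨h1, h2, h3, h4⟩ := (ih1 a).1 ha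
        refine ⟨List.pairwise_cons.2 ⟨h3, h1⟩, by simp [h2], by simpa using h3, ?_⟩
        intro i hi
        cases i with
        | zero => simp
        | succ i =>
          have := h4 i (by simpa using hi)
          simp only [List.getElem_cons_succ]
          rw [mul_add]; omega
      · obtain ⟨h1, h2, h3, h4⟩ := (ih2 a).1 ha
        refine ⟨?_, by simp [h2], by simp, ?_⟩
        · rw [List.pairwise_map]; simpa using h1
        · intro i hi
          have := h4 i (by simpa using hi)
          simp only [List.getElem_map]; omega
    · rintro ⟨h1, h2, h3, h4⟩
      cases l with
      | nil => simp at h2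
      | cons x t =>
        rw [List.pairwise_cons] at h1
        have hx := h3 x (by simp)
        rcases Nat.eq_or_lt_of_le hx with hx1 | hx1
        · left
          refine ⟨t, (ih1 t).2 ⟨h1.2, by simpa using h2, fun y hy => h3 y (by simp [hy]), ?_⟩, by rw [← hx1]⟩
          intro i hi
          have := h4 (i + 1) (by simpa using hi)
          simp only [List.getElem_cons_succ] at this
          rw [mul_add] at this; omega
        · right
          have h5 : ∀ y ∈ x :: t, 2 ≤ y := by
            intro y hy
            rcases List.mem_cons.1 hy with rfl | hy
            · exact hx1
            · exact le_trans hx1 (h1.1 y hy)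
          refine ⟨(x :: t).map (· - 1), (ih2 _).2 ⟨?_, by simpa using h2, ?_, ?_⟩, ?_⟩
          · rw [List.pairwise_map]
            refine (List.pairwise_cons.2 h1).imp ?_
            intro a b h; omega
          · intro y hy
            obtain ⟨z, hz, rfl⟩ := List.mem_map.1 hy
            have := h5 z hz; omega
          · intro i hi
            have := h4 i (by simpa using hi)
            simp only [List.getElem_map]; omega
          · rw [List.map_map]
            conv_rhs => rw [← List.map_id (x :: t)]
            apply List.map_congr_left
            intro y hy
            have := h5 y hy
            simp only [Function.comp, id]; omega

theorem card_fT (M n r : ℕ) : (fT M n r).card = fL M n r := by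
  induction n, r using fL.induct M with
  | case1 r => simp [fT, fL]
  | case2 n => simp [fT, fL]
  | case3 n r ih1 ih2 =>
    rw [fT, fL, Finset.card_union_of_disjoint, Finset.card_image_of_injective _ (List.cons_injective),
      Finset.card_image_of_injective, ih1, ih2]
    · exact List.map_injective_iff.2 (fun a b h => by simpa using h)
    · rw [Finset.disjoint_left]
      intro l h1 h2
      obtain ⟨a, _, rfl⟩ := Finset.mem_image.1 h1
      obtain ⟨b, hb, h⟩ := Finset.mem_image.1 h2
      cases b with
      | nil => simp at h
      | cons y b =>
        have := ((mem_fT _ _ _ _).1 hb).2.2.1 y (by simp)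
        simp at h; omega

open PowerSeries in
theorem ps_unique (M : ℕ) (H H' : ℕ → PowerSeries ℚ) (h0 : H 0 = H' 0)
    (h : ∀ r, H (r + 1) = H r + X * H (r + 1 + M))
    (h' : ∀ r, H' (r + 1) = H' r + X * H' (r + 1 + M)) (r : ℕ) : H r = H' r := by
  ext n
  induction n, r using fL.induct M with
  | case1 r =>
    induction r with
    | zero => rw [h0]
    | succ r ih => rw [h, h']; simpa using ih
  | case2 n => rw [h0]
  | case3 n r ih1 ih2 =>
    rw [h, h', map_add, map_add, coeff_succ_X_mul, coeff_succ_X_mul, ih1, ih2]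

open PowerSeries in
noncomputable def fG (M r : ℕ) : PowerSeries ℚ := PowerSeries.mk fun n => (fL M n r : ℚ)

open PowerSeries in
theorem fG_zero (M : ℕ) : fG M 0 = 1 := by
  ext n
  cases n <;> simp [fG, fL, coeff_one]

open PowerSeries in
theorem fG_succ (M r : ℕ) : fG M (r + 1) = fG M r + X * fG M (r + 1 + M) := by
  ext n
  cases n with
  | zero => simp [fG, fL]
  | succ n => rw [map_add, coeff_succ_X_mul]; simp [fG, fL]; ring

theorem fG_add (M r s : ℕ) : fG M (r + s) = fG M r * fG M s := by
  refine ps_unique M (fun r => fG M (r + s)) (fun r => fG M r * fG M s) ?_ ?_ ?_ r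
  · simp [fG_zero]
  · intro r
    have := fG_succ M (r + s)
    rw [show r + 1 + s = r + s + 1 by ring, show r + 1 + M + s = r + s + 1 + M by ring]
    exact this
  · intro r
    rw [fG_succ M r]; ring

theorem fG_pow (M r : ℕ) : fG M r = fG M 1 ^ r := by
  induction r with
  | zero => simp [fG_zero]
  | succ r ih => rw [fG_add, pow_succ, ih]

theorem fL_closed (M n r : ℕ) : fL M n r * (n * (M + 1) + r) = r * (n * (M + 1) + r).choose n := by
  induction n, r using fL.induct M with
  | case1 r => simp [fL]
  | case2 n => simp [fL]
  | case3 n r ih1 ih2 =>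
    rw [fL]
    set N := (n + 1) * (M + 1) + r with hN
    have e1 : n * (M + 1) + (r + 1 + M) = N := by rw [hN]; ring
    rw [e1] at ih1
    have e2 : (n + 1) * (M + 1) + (r + 1) = N + 1 := by rw [hN]; ring
    rw [e2]
    -- C(N,n+1)*(n+1) = C(N,n)*(N-n)
    have h1 := Nat.choose_succ_right_eq N n
    have hle : n ≤ N := by rw [hN]; nlinarith
    obtain ⟨d, hd⟩ := Nat.exists_eq_add_of_le hle
    rw [show N - n = d by omega] at h1
    have hNpos : 0 < N := by rw [hN]; positivity
    rw [Nat.choose_succ_succ]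
    generalize N.choose n = A at *
    generalize N.choose (n + 1) = B at *
    apply Nat.eq_of_mul_eq_mul_left hNpos
    apply Nat.eq_of_mul_eq_mul_left (Nat.succ_pos n)
    have hd' : n + d = (n + 1) * (M + 1) + r := by rw [← hd, hN]
    clear_value N
    zify at *
    have hd2 : (d : ℤ) = (n + 1) * (M + 1) + r - n := by linarith
    generalize (fL M n (r + 1 + M) : ℤ) = U at *
    generalize (fL M (n + 1) r : ℤ) = V at *
    rw [hd2] at h1
    rw [hN] at ih1 ih2 ⊢
    linear_combination ((n:ℤ)+1) * ((n + 1) * (M + 1) + r + 1) * (ih1 + ih2) +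
      (r - ((n + 1) * (M + 1) + r) : ℤ) * h1

theorem count_eq (m n : ℕ) : hypoParkCount m n = fL (2 * m) n 1 := by
  have hc : Nat.card (fT (2 * m) n 1) = fL (2 * m) n 1 := by
    rw [Nat.card_eq_fintype_card, Fintype.card_coe, card_fT]
  rw [← hc, hypoParkCount]
  symm
  refine Nat.card_eq_of_bijective (fun b => Quotient.mk _ ⟨Phi b.1, ?_⟩) ⟨?_, ?_⟩
  · obtain ⟨h1, h2, h3, h4⟩ := (mem_fT _ _ _ _).1 b.2
    exact ⟨by rw [Phi_length, h2], (Phi_parking m _ h1).2 h4⟩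
  · rintro ⟨b, hb⟩ ⟨b', hb'⟩ h
    obtain ⟨h1, h2, h3, h4⟩ := (mem_fT _ _ _ _).1 hb
    obtain ⟨h1', h2', h3', h4'⟩ := (mem_fT _ _ _ _).1 hb'
    have h : HypoEqv (Phi b) (Phi b') := Quotient.exact h
    apply Subtype.ext
    refine Phi_inj h1 h1' (fun h => by simpa using h3 0 h) (fun h => by simpa using h3' 0 h) ?_ h
    intro hne
    have hpos : 0 < b.length := List.length_pos_iff.2 hne
    have e1 := h4 0 hpos
    have e2 := h3 b[0] (List.getElem_mem _)
    have : b[0] = 1 := by omega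
    have hmem := List.getElem_mem hpos
    rw [this] at hmem; exact hmem
  · intro q
    induction q using Quotient.inductionOn with
    | _ w =>
      obtain ⟨w, hn, hw⟩ := w
      obtain ⟨b, hb1, hb2, hb3⟩ := exists_nf_s15 n w hn hw.1
      have hp := hw.perm hb3.perm
      refine ⟨⟨b, (mem_fT _ _ _ _).2 ⟨hb1, ?_, hb2, (Phi_parking m b hb1).1 hp⟩⟩, ?_⟩
      · rw [← Phi_length, ← hb3.perm.length_eq, hn]
      · exact Quotient.sound (.symm _ _ hb3)

open PowerSeries in
/-- The generating function `X(t)` of the numbers of hyposylvester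
classes of `m`-parking functions of length `n` satisfies `X = 1 + t·X^(2m+1)`; hence
this number equals the number of `(2m+1)`-ary trees with `n` internal nodes,
`(1/(2mn+1))·C((2m+1)n, n)`. -/
theorem hyposylvester_mParking_ogf (m : ℕ) (hm : 1 ≤ m) :
    (PowerSeries.mk fun n => (hypoParkCount m n : ℚ)) =
        1 + X * (PowerSeries.mk fun n => (hypoParkCount m n : ℚ)) ^ (2 * m + 1) ∧
      ∀ n : ℕ, hypoParkCount m n =
        Nat.choose ((2 * m + 1) * n) n / (2 * m * n + 1) := by
  have hG : (PowerSeries.mk fun n => (hypoParkCount m n : ℚ)) = fG (2 * m) 1 := by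
    simp only [count_eq, fG]
  refine ⟨?_, ?_⟩
  · rw [hG]
    conv_lhs => rw [fG_succ (2 * m) 0, fG_zero, fG_pow (2 * m) (0 + 1 + 2 * m)]
    rw [show 0 + 1 + 2 * m = 2 * m + 1 by ring]
  · intro n
    rw [count_eq]
    symm
    apply Nat.div_eq_of_eq_mul_left (by omega)
    have h1 := fL_closed (2 * m) n 1
    have h2 := Nat.choose_mul_succ_eq ((2 * m + 1) * n) n
    rw [one_mul, mul_comm n (2 * m + 1)] at h1
    rw [← h1, show (2 * m + 1) * n + 1 - n = 2 * m * n + 1 by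
      rw [add_mul]; omega] at h2
    apply Nat.eq_of_mul_eq_mul_right (show 0 < (2 * m + 1) * n + 1 by omega)
    rw [h2]; ring
end
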